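/- Let n ≥ 1, let Q_1, …, Q_k be n×n complex matrices that are pairwise orthogonal Hermitian projections (Q_i * Q_i = Q_i, Q_iᴴ = Q_i, and Q_i * Q_j = 0 for i ≠ j) with Q_1 + ⋯ + Q_k = I. Let E(X) = Σ_{i=1}^k Q_i X Q_i. Then for every positive semidefinite n×n complex matrix A and every real p ≥ 2, Re(trace(|A − E(A)|^p)) ≤ Re(trace(A^p)). -/

import Mathlib

open ComplexOrder Matrix

section HermitianCFC

variable {ι : Type*} [Fintype ι]

theorem Matrix.PosSemidef.re_trace_nonneg {M : Matrix ι ι ℂ} (hM : M.PosSemidef) :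
    0 ≤ (trace M).re :=
  (Complex.nonneg_iff.mp hM.trace_nonneg).1

theorem Matrix.IsHermitian.re_trace_mul_self_nonneg {M : Matrix ι ι ℂ} (hM : M.IsHermitian) :
    0 ≤ (trace (M * M)).re := by
  have h := (posSemidef_conjTranspose_mul_self M).re_trace_nonneg
  rwa [hM.eq] at h

variable [DecidableEq ι]

/-- Every real function of a Hermitian matrix has as trace the sum of its values at the
eigenvalues. -/
theorem Matrix.IsHermitian.re_trace_cfc {M : Matrix ι ι ℂ} (hM : M.IsHermitian) (f : ℝ → ℝ) :
    (trace (cfc f M)).re = ∑ i, f (hM.eigenvalues i) := by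
  rw [hM.cfc_eq, Matrix.IsHermitian.cfc, Unitary.conjStarAlgAut_apply, trace_mul_cycle,
    Unitary.coe_star_mul_self, one_mul, trace_diagonal, Complex.re_sum]
  simp

theorem Matrix.IsHermitian.posSemidef_cfc {M : Matrix ι ι ℂ} (hM : M.IsHermitian) {f : ℝ → ℝ}
    (hf : ∀ x, 0 ≤ f x) : (cfc f M).PosSemidef := by
  rw [hM.cfc_eq, Matrix.IsHermitian.cfc, Unitary.conjStarAlgAut_apply]
  refine PosSemidef.mul_mul_conjTranspose_same (PosSemidef.diagonal fun i => ?_) _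
  simpa using hf _

theorem Matrix.isHermitian_cfc (f : ℝ → ℝ) (M : Matrix ι ι ℂ) : (cfc f M).IsHermitian :=
  cfc_predicate f M

theorem Matrix.cfc_mul_cfc (f g : ℝ → ℝ) (M : Matrix ι ι ℂ) :
    cfc f M * cfc g M = cfc (fun x => f x * g x) M :=
  (cfc_mul f g M (M.finite_real_spectrum.continuousOn f)
    (M.finite_real_spectrum.continuousOn g)).symm

theorem Matrix.cfc_sub_cfc (f g : ℝ → ℝ) (M : Matrix ι ι ℂ) :
    cfc f M - cfc g M = cfc (fun x => f x - g x) M :=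
  (cfc_sub f g M (M.finite_real_spectrum.continuousOn f)
    (M.finite_real_spectrum.continuousOn g)).symm

theorem Matrix.IsHermitian.mul_cfc {M : Matrix ι ι ℂ} (hM : M.IsHermitian) (f : ℝ → ℝ) :
    M * cfc f M = cfc (fun x => x * f x) M := by
  rw [← cfc_mul_cfc (fun x => x) f M, cfc_id' ℝ M hM.isSelfAdjoint]

theorem Matrix.IsHermitian.cfc_sub_self {M : Matrix ι ι ℂ} (hM : M.IsHermitian) (f : ℝ → ℝ) :
    cfc f M - M = cfc (fun x => f x - x) M := by
  rw [← cfc_sub_cfc f (fun x => x) M, cfc_id' ℝ M hM.isSelfAdjoint]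

theorem Matrix.PosSemidef.re_trace_mul_nonneg {M N : Matrix ι ι ℂ} (hM : M.PosSemidef)
    (hN : N.PosSemidef) : 0 ≤ (trace (M * N)).re := by
  have hsq : cfc Real.sqrt M * cfc Real.sqrt M = M := by
    rw [cfc_mul_cfc]
    conv_rhs => rw [← cfc_id' ℝ M hM.isHermitian.isSelfAdjoint]
    refine cfc_congr fun x hx => ?_
    rw [hM.isHermitian.spectrum_real_eq_range_eigenvalues] at hx
    obtain ⟨i, rfl⟩ := hx
    exact Real.mul_self_sqrt (hM.eigenvalues_nonneg i)
  have h := (hN.mul_mul_conjTranspose_same (cfc Real.sqrt M)).re_trace_nonneg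
  rwa [(isHermitian_cfc Real.sqrt M).eq, trace_mul_cycle, hsq] at h

end HermitianCFC

section Pinching

variable {ι κ : Type*} [Fintype ι] [Fintype κ]

/-- The pinching `M ↦ ∑ i, Q i * M * Q i` by a family of matrices. -/
def pinching (Q : κ → Matrix ι ι ℂ) (M : Matrix ι ι ℂ) : Matrix ι ι ℂ := ∑ i, Q i * M * Q i

theorem pinching_sub (Q : κ → Matrix ι ι ℂ) (M N : Matrix ι ι ℂ) :
    pinching Q (M - N) = pinching Q M - pinching Q N := by
  simp [pinching, mul_sub, sub_mul]

theorem posSemidef_pinching {Q : κ → Matrix ι ι ℂ} (hQ : ∀ i, (Q i)ᴴ = Q i)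
    {M : Matrix ι ι ℂ} (hM : M.PosSemidef) : (pinching Q M).PosSemidef := by
  refine posSemidef_sum _ fun i _ => ?_
  have h := hM.mul_mul_conjTranspose_same (Q i)
  rwa [hQ i] at h

theorem isHermitian_pinching {Q : κ → Matrix ι ι ℂ} (hQ : ∀ i, (Q i)ᴴ = Q i)
    {M : Matrix ι ι ℂ} (hM : M.IsHermitian) : (pinching Q M).IsHermitian := by
  simp [IsHermitian, pinching, conjTranspose_sum, hQ, hM.eq, mul_assoc]

theorem trace_pinching_mul (Q : κ → Matrix ι ι ℂ) (M N : Matrix ι ι ℂ) :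
    trace (pinching Q M * N) = trace (M * pinching Q N) := by
  simp only [pinching, Finset.sum_mul, Finset.mul_sum, trace_sum]
  refine Finset.sum_congr rfl fun i _ => ?_
  rw [mul_assoc, mul_assoc, trace_mul_comm, mul_assoc, mul_assoc]

theorem pinching_pinching {Q : κ → Matrix ι ι ℂ} (hQproj : ∀ i, Q i * Q i = Q i)
    (hQorth : ∀ i j, i ≠ j → Q i * Q j = 0) (M : Matrix ι ι ℂ) :
    pinching Q (pinching Q M) = pinching Q M := by
  simp only [pinching, Finset.mul_sum, Finset.sum_mul]
  refine Finset.sum_congr rfl fun i _ => ?_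
  rw [Finset.sum_eq_single i]
  · rw [← mul_assoc, ← mul_assoc, hQproj, mul_assoc, hQproj]
  · intro j _ hj
    rw [← mul_assoc, ← mul_assoc, hQorth i j hj.symm]
    simp
  · simp

theorem re_trace_sub_pinching_mul_self_le {Q : κ → Matrix ι ι ℂ} (hQherm : ∀ i, (Q i)ᴴ = Q i)
    (hQproj : ∀ i, Q i * Q i = Q i) (hQorth : ∀ i j, i ≠ j → Q i * Q j = 0)
    {Y : Matrix ι ι ℂ} (hY : Y.IsHermitian) :
    (trace ((Y - pinching Q Y) * (Y - pinching Q Y))).re ≤ (trace (Y * Y)).re := by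
  have h := (isHermitian_pinching hQherm hY).re_trace_mul_self_nonneg
  have h1 := trace_pinching_mul Q Y (pinching Q Y)
  rw [pinching_pinching hQproj hQorth] at h1
  have h2 := trace_mul_comm (pinching Q Y) Y
  simp only [mul_sub, sub_mul, trace_sub, Complex.sub_re, h2, h1] at h ⊢
  linarith

variable [DecidableEq ι]

theorem trace_pinching {Q : κ → Matrix ι ι ℂ} (hQproj : ∀ i, Q i * Q i = Q i)
    (hQsum : ∑ i, Q i = 1) (M : Matrix ι ι ℂ) : trace (pinching Q M) = trace M := by
  have h := trace_pinching_mul Q M 1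
  have h1 : pinching Q 1 = 1 := by simp [pinching, hQproj, hQsum]
  rwa [h1, mul_one, mul_one] at h

/-- The trace of the positive part of `Y - E Y` is at most the trace norm of `Y`. -/
theorem re_trace_posPart_sub_pinching_le {Q : κ → Matrix ι ι ℂ} (hQherm : ∀ i, (Q i)ᴴ = Q i)
    (hQproj : ∀ i, Q i * Q i = Q i) (hQsum : ∑ i, Q i = 1)
    {P N : Matrix ι ι ℂ} (hP : P.PosSemidef) (hN : N.PosSemidef) :
    (trace (cfc (fun x : ℝ => max x 0) (P - N - pinching Q (P - N)))).re ≤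
      (trace P).re + (trace N).re := by
  set V := P - N - pinching Q (P - N) with hV
  have hVh : V.IsHermitian := by
    have h := hP.isHermitian.sub hN.isHermitian
    exact h.sub (isHermitian_pinching hQherm h)
  set S := cfc (fun x : ℝ => if 0 < x then (1 : ℝ) else 0) V with hS
  have hS0 : S.PosSemidef := hVh.posSemidef_cfc fun x => by split_ifs <;> norm_num
  have hS1 : (1 - S).PosSemidef := by
    rw [← cfc_const_one ℝ V hVh.isSelfAdjoint, hS, cfc_sub_cfc]
    exact hVh.posSemidef_cfc fun x => by split_ifs <;> norm_num
  have hVS : cfc (fun x : ℝ => max x 0) V = V * S := by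
    rw [hS, hVh.mul_cfc]
    congr 1
    ext x
    split_ifs with h
    · simp [h.le]
    · simp [not_lt.mp h]
  have h1 := hP.re_trace_mul_nonneg hS1
  have h2 := hN.re_trace_mul_nonneg hS0
  have h3 := (posSemidef_pinching hQherm hP).re_trace_mul_nonneg hS0
  have h4 := (posSemidef_pinching hQherm hN).re_trace_mul_nonneg hS1
  have h5 := trace_pinching hQproj hQsum N
  rw [hVS, hV, pinching_sub]
  simp only [mul_sub, sub_mul, mul_one, trace_sub, Complex.sub_re, h5] at h1 h2 h3 h4 ⊢
  linarith

/-- The contraction `Tr f(|A - E A|) ≤ Tr f(A)` for the truncated square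
`f x = (x - t)₊ ^ 2`. -/
theorem re_trace_truncated_sq_sub_pinching_le {Q : κ → Matrix ι ι ℂ}
    (hQherm : ∀ i, (Q i)ᴴ = Q i) (hQproj : ∀ i, Q i * Q i = Q i)
    (hQorth : ∀ i j, i ≠ j → Q i * Q j = 0) (hQsum : ∑ i, Q i = 1)
    {A : Matrix ι ι ℂ} (hA : A.PosSemidef) {t : ℝ} (ht : 0 ≤ t) :
    (trace (cfc (fun x : ℝ => max (|x| - t) 0 ^ 2) (A - pinching Q A))).re ≤
      (trace (cfc (fun x : ℝ => max (x - t) 0 ^ 2) A)).re := by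
  set X := A - pinching Q A with hX
  have hXh : X.IsHermitian := hA.isHermitian.sub (isHermitian_pinching hQherm hA.isHermitian)
  set P := cfc (fun x : ℝ => max (x - t) 0) X with hPdef
  set N := cfc (fun x : ℝ => max (-x - t) 0) X with hNdef
  have hP : P.PosSemidef := hXh.posSemidef_cfc fun x => le_max_right _ _
  have hN : N.PosSemidef := hXh.posSemidef_cfc fun x => le_max_right _ _
  set Y := P - N with hYdef
  have hY : Y.IsHermitian := hP.isHermitian.sub hN.isHermitian
  have hsplit : (trace (cfc (fun x : ℝ => max (|x| - t) 0 ^ 2) X)).re =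
      2 * (trace (X * Y)).re - 2 * t * ((trace P).re + (trace N).re) - (trace (Y * Y)).re := by
    rw [hYdef, hPdef, hNdef, cfc_sub_cfc, cfc_mul_cfc, hXh.mul_cfc]
    simp only [hXh.re_trace_cfc, ← Finset.sum_add_distrib, Finset.mul_sum,
      ← Finset.sum_sub_distrib]
    refine Finset.sum_congr rfl fun i _ => ?_
    generalize hXh.eigenvalues i = x
    rcases abs_cases x with ⟨h, h'⟩ | ⟨h, h'⟩ <;> rw [h] <;>
      rcases max_cases (x - t) 0 with ⟨h1, h1'⟩ | ⟨h1, h1'⟩ <;>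
      rcases max_cases (-x - t) 0 with ⟨h2, h2'⟩ | ⟨h2, h2'⟩ <;> rw [h1, h2] <;>
      first | ring1 | nlinarith
  set V := Y - pinching Q Y with hVdef
  have hV : V.IsHermitian := hY.sub (isHermitian_pinching hQherm hY)
  set W := cfc (fun x : ℝ => max x 0) V with hWdef
  have hW : W.PosSemidef := hV.posSemidef_cfc fun x => le_max_right _ _
  have hXY : trace (X * Y) = trace (A * V) := by
    rw [hX, hVdef, sub_mul, mul_sub A Y, trace_sub, trace_sub, trace_pinching_mul]
  have hAV : (trace (A * V)).re ≤ (trace (A * W)).re := by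
    have h : (W - V).PosSemidef := by
      rw [hWdef, hV.cfc_sub_self]
      exact hV.posSemidef_cfc fun x => sub_nonneg.mpr (le_max_left _ _)
    have := hA.re_trace_mul_nonneg h
    rw [mul_sub, trace_sub, Complex.sub_re] at this
    linarith
  have hWtr : (trace W).re ≤ (trace P).re + (trace N).re :=
    re_trace_posPart_sub_pinching_le hQherm hQproj hQsum hP hN
  have hWsq : (trace (W * W)).re ≤ (trace (Y * Y)).re := by
    refine le_trans ?_ (re_trace_sub_pinching_mul_self_le hQherm hQproj hQorth hY)
    rw [← hVdef, hWdef, cfc_mul_cfc]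
    conv_rhs => rw [← cfc_id' ℝ V hV.isSelfAdjoint, cfc_mul_cfc]
    simp only [hV.re_trace_cfc]
    refine Finset.sum_le_sum fun i _ => ?_
    rcases max_cases (hV.eigenvalues i) 0 with ⟨h, _⟩ | ⟨h, _⟩ <;> rw [h]
    nlinarith [mul_self_nonneg (hV.eigenvalues i)]
  set C := cfc (fun x : ℝ => max (x - t) 0) A with hCdef
  have hAW : (trace (A * W)).re ≤ (trace (C * W)).re + t * (trace W).re := by
    have h : (C - cfc (fun x : ℝ => x - t) A).PosSemidef := by
      rw [hCdef, cfc_sub_cfc]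
      exact hA.isHermitian.posSemidef_cfc fun x => sub_nonneg.mpr (le_max_left _ _)
    have hAt : cfc (fun x : ℝ => x - t) A = A - (t : ℂ) • 1 := by
      rw [← cfc_sub_cfc (fun x => x) (fun _ => t), cfc_id' ℝ A hA.isHermitian.isSelfAdjoint,
        cfc_const t A hA.isHermitian.isSelfAdjoint, Algebra.algebraMap_eq_smul_one]
      simp
    have := h.re_trace_mul_nonneg hW
    rw [hAt] at this
    simp only [sub_mul, trace_sub, smul_mul_assoc, one_mul, trace_smul, Complex.sub_re,
      smul_eq_mul, Complex.re_ofReal_mul] at this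
    linarith
  have hCW : 2 * (trace (C * W)).re ≤ (trace (C * C)).re + (trace (W * W)).re := by
    have hC : C.IsHermitian := isHermitian_cfc _ A
    have h := (hC.sub hW.isHermitian).re_trace_mul_self_nonneg
    have h2 := trace_mul_comm W C
    simp only [mul_sub, sub_mul, trace_sub, Complex.sub_re, h2] at h
    linarith
  have hCC : cfc (fun x : ℝ => max (x - t) 0 ^ 2) A = C * C := by
    simp only [hCdef, cfc_mul_cfc, sq]
  rw [hsplit, hXY, hCC]
  have := mul_le_mul_of_nonneg_left hWtr ht
  linarith

end Pinching

section LayerCake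

open MeasureTheory Set

theorem integrableOn_rpow_mul_truncated_sq {p : ℝ} (hp : 2 < p) (x : ℝ) :
    IntegrableOn (fun t : ℝ => t ^ (p - 3) * max (x - t) 0 ^ 2) (Ioi 0) := by
  have h1 : IntegrableOn (fun t : ℝ => t ^ (p - 3) * max (x - t) 0 ^ 2) (Ioc 0 |x|) := by
    have h := intervalIntegral.intervalIntegrable_rpow' (a := 0) (b := |x|)
      (show -1 < p - 3 by linarith)
    have h' := h.mul_continuousOn (g := fun t : ℝ => max (x - t) 0 ^ 2) (by fun_prop)
    exact (intervalIntegrable_iff_integrableOn_Ioc_of_le (abs_nonneg x)).mp h'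
  have h2 : IntegrableOn (fun t : ℝ => t ^ (p - 3) * max (x - t) 0 ^ 2) (Ioi |x|) := by
    refine integrableOn_zero.congr_fun (fun t ht => ?_) measurableSet_Ioi
    have : x - t ≤ 0 := by linarith [le_abs_self x, mem_Ioi.mp ht]
    simp [max_eq_right this]
  rw [← Ioc_union_Ioi_eq_Ioi (abs_nonneg x)]
  exact h1.union h2

/-- Powers larger than two are mixtures of the truncated squares `(x - t)₊ ^ 2`. -/
theorem integral_rpow_mul_truncated_sq {p : ℝ} (hp : 2 < p) {x : ℝ} (hx : 0 ≤ x) :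
    ∫ t in Ioi (0 : ℝ), t ^ (p - 3) * max (x - t) 0 ^ 2 =
      x ^ p * ∫ t in Ioi (0 : ℝ), t ^ (p - 3) * max (1 - t) 0 ^ 2 := by
  rcases hx.eq_or_lt with rfl | hx
  · rw [Real.zero_rpow (by linarith), zero_mul]
    refine setIntegral_eq_zero_of_forall_eq_zero fun t ht => ?_
    have : (0 : ℝ) - t ≤ 0 := by linarith [mem_Ioi.mp ht]
    rw [max_eq_right this]
    ring
  · have h := integral_comp_mul_left_Ioi
      (fun t : ℝ => t ^ (p - 3) * max (x - t) 0 ^ 2) 0 hx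
    rw [mul_zero, smul_eq_mul, eq_inv_mul_iff_mul_eq₀ hx.ne'] at h
    rw [← h, ← integral_const_mul, ← integral_const_mul]
    refine setIntegral_congr_fun measurableSet_Ioi fun t ht => ?_
    have ht' : 0 ≤ t := (mem_Ioi.mp ht).le
    have hmax : max (x - x * t) 0 = x * max (1 - t) 0 := by
      rw [mul_max_of_nonneg _ _ hx.le, mul_zero]
      ring_nf
    have hxp : x ^ p = x ^ (p - 3) * x ^ 3 := by
      rw [← Real.rpow_natCast, ← Real.rpow_add hx]
      norm_num
    simp only [hmax, Real.mul_rpow hx.le ht', hxp]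
    ring

theorem integral_rpow_mul_truncated_sq_one_pos {p : ℝ} (hp : 2 < p) :
    0 < ∫ t in Ioi (0 : ℝ), t ^ (p - 3) * max (1 - t) 0 ^ 2 := by
  rw [setIntegral_pos_iff_support_of_nonneg_ae _ (integrableOn_rpow_mul_truncated_sq hp 1)]
  · have hsub : Ioo (0 : ℝ) 1 ⊆
        (Function.support fun t : ℝ => t ^ (p - 3) * max (1 - t) 0 ^ 2) ∩ Ioi 0 := by
      intro t ht
      have h1 : 0 < max (1 - t) 0 := lt_max_of_lt_left (by linarith [ht.2])
      exact ⟨(mul_pos (Real.rpow_pos_of_pos ht.1 _) (pow_pos h1 2)).ne', ht.1⟩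
    refine lt_of_lt_of_le ?_ (measure_mono hsub)
    simp
  · filter_upwards [ae_restrict_mem measurableSet_Ioi] with t ht
    exact mul_nonneg (Real.rpow_nonneg (mem_Ioi.mp ht).le _) (sq_nonneg _)

theorem sum_rpow_le_sum_rpow_of_truncated_sq {ι κ : Type*} [Fintype ι] [Fintype κ]
    {x : ι → ℝ} {y : κ → ℝ} (hx : ∀ i, 0 ≤ x i) (hy : ∀ j, 0 ≤ y j)
    (h : ∀ t, 0 ≤ t → ∑ i, max (x i - t) 0 ^ 2 ≤ ∑ j, max (y j - t) 0 ^ 2)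
    {p : ℝ} (hp : 2 ≤ p) : ∑ i, x i ^ p ≤ ∑ j, y j ^ p := by
  rcases hp.eq_or_lt with rfl | hp
  · simpa [hx, hy] using h 0 le_rfl
  · refine le_of_mul_le_mul_right ?_ (integral_rpow_mul_truncated_sq_one_pos hp)
    rw [Finset.sum_mul, Finset.sum_mul]
    simp_rw [← integral_rpow_mul_truncated_sq hp (hx _),
      ← integral_rpow_mul_truncated_sq hp (hy _)]
    rw [← integral_finsetSum _ fun i _ => integrableOn_rpow_mul_truncated_sq hp (x i),
      ← integral_finsetSum _ fun j _ => integrableOn_rpow_mul_truncated_sq hp (y j)]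
    refine setIntegral_mono_on
      (integrable_finsetSum _ fun i _ => integrableOn_rpow_mul_truncated_sq hp (x i))
      (integrable_finsetSum _ fun j _ => integrableOn_rpow_mul_truncated_sq hp (y j))
      measurableSet_Ioi fun t ht => ?_
    have ht' : 0 ≤ t := (mem_Ioi.mp ht).le
    rw [← Finset.mul_sum, ← Finset.mul_sum]
    exact mul_le_mul_of_nonneg_left (h t ht') (Real.rpow_nonneg ht' _)

end LayerCake

/-- For `n ≥ 1` and pairwise orthogonal Hermitian projections `Q 1, …, Q k` summing to
the identity, the conditional expectation `E X = ∑ i, Q i * X * Q i` satisfies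
`Re (trace |A - E A|^p) ≤ Re (trace (A^p))` for every positive semidefinite `A` and
every real `p ≥ 2`; the powers are given by the continuous functional calculus. -/
theorem stmt_13 (n : ℕ) (hn : 1 ≤ n) (k : ℕ) (Q : Fin k → Matrix (Fin n) (Fin n) ℂ)
    (hQproj : ∀ i, Q i * Q i = Q i) (hQherm : ∀ i, (Q i)ᴴ = Q i)
    (hQorth : ∀ i j, i ≠ j → Q i * Q j = 0) (hQsum : ∑ i, Q i = 1)
    (A : Matrix (Fin n) (Fin n) ℂ) (hA : A.PosSemidef) (p : ℝ) (hp : 2 ≤ p) :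
    (Matrix.trace (cfc (fun t : ℝ => |t| ^ p) (A - ∑ i, Q i * A * Q i))).re ≤
      (Matrix.trace (cfc (fun t : ℝ => t ^ p) A)).re := by
  change (trace (cfc (fun t : ℝ => |t| ^ p) (A - pinching Q A))).re ≤ _
  have hX : (A - pinching Q A).IsHermitian :=
    hA.isHermitian.sub (isHermitian_pinching hQherm hA.isHermitian)
  rw [hX.re_trace_cfc, hA.isHermitian.re_trace_cfc]
  refine sum_rpow_le_sum_rpow_of_truncated_sq (fun i => abs_nonneg _) hA.eigenvalues_nonneg
    (fun t ht => ?_) hp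
  have h := re_trace_truncated_sq_sub_pinching_le hQherm hQproj hQorth hQsum hA ht
  rwa [hX.re_trace_cfc, hA.isHermitian.re_trace_cfc] at h
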